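/- arXiv:1111.1376 — 3 statements merged into one kernel-verified Lean document; each statement's English description precedes it below -/
import Mathlib

section
/- For all n, k with 2 ≤ n and 2 ≤ k < 2^(n−1), the number τ_{n,k} of separating families of k arbitrary bipartitions of an n-element set satisfies τ_{n,k} = ∑_{i=1}^{n−1} (−1)^(n−1−i) · c(n, i+1) · C(2^i, k), where c(·,·) is the unsigned Stirling number of the first kind and C(·,·) is the binomial coefficient. -/
open Finset

variable {α : Type*} [DecidableEq α]

/-- A *bipartition* of a finite set `S`: a collection of at most two pairwise disjoint
nonempty subsets of `S` whose union is `S`. -/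
def IsBipartition (S : Finset α) (P : Finset (Finset α)) : Prop :=
  P.card ≤ 2 ∧ (∀ A ∈ P, A.Nonempty) ∧
    (∀ A ∈ P, ∀ B ∈ P, A ≠ B → Disjoint A B) ∧ P.sup id = S

/-- The bipartition `P` *cuts* the elements `x` and `y`:
they lie in different components of `P`. -/
def Cuts (P : Finset (Finset α)) (x y : α) : Prop :=
  ∃ A ∈ P, ∃ B ∈ P, A ≠ B ∧ x ∈ A ∧ y ∈ B

/-- A family `F` of bipartitions is *separating* for `S` if every two distinct
elements of `S` are cut by some member of `F`. -/
def IsSeparating (S : Finset α) (F : Finset (Finset (Finset α))) : Prop :=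
  ∀ x ∈ S, ∀ y ∈ S, x ≠ y → ∃ P ∈ F, Cuts P x y

/-- A separating family is *minimal* if no proper subfamily is separating. -/
def IsMinimalSeparating (S : Finset α) (F : Finset (Finset (Finset α))) : Prop :=
  IsSeparating S F ∧ ∀ F2 ⊂ F, ¬ IsSeparating S F2

/-- `tauSep n k` is the number of separating families consisting of `k` arbitrary
bipartitions of an `n`-element set. -/
noncomputable def tauSep (n k : ℕ) : ℕ :=
  Set.ncard {F : Finset (Finset (Finset (Fin n))) |
    (∀ P ∈ F, IsBipartition Finset.univ P) ∧
      IsSeparating Finset.univ F ∧ F.card = k}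

/-- The unsigned Stirling numbers of the first kind: `stirling1 n k` is the number of
permutations of an `n`-element set with exactly `k` cycles. -/
def stirling1 : ℕ → ℕ → ℕ
  | 0, 0 => 1
  | 0, _ + 1 => 0
  | _ + 1, 0 => 0
  | n + 1, k + 1 => n * stirling1 n (k + 1) + stirling1 n k

/-- The number of surjections from a `k`-element set onto a `j`-element set. -/
noncomputable def surjCount (k j : ℕ) : ℕ :=
  Fintype.card {f : Fin k → Fin j // Function.Surjective f}

theorem surjCount_self_pos (k : ℕ) : 0 < surjCount k k :=
  Fintype.card_pos_iff.mpr ⟨⟨id, Function.surjective_id⟩⟩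

theorem card_filter_image_eq {β : Type*} [Fintype β] [DecidableEq β] (k : ℕ) (F : Finset β) :
    #{f : Fin k → β | univ.image f = F} = surjCount k #F := by
  rw [surjCount, ← Fintype.card_coe]
  have hmem (f : Fin k → β) (hf : univ.image f = F) (i : Fin k) : f i ∈ F :=
    hf ▸ mem_image_of_mem f (mem_univ i)
  refine Fintype.card_congr
    { toFun := fun f ↦ ⟨fun i ↦ F.equivFin ⟨f.1 i, hmem f.1 (mem_filter.mp f.2).2 i⟩, ?_⟩
      invFun := fun f ↦ ⟨fun i ↦ (F.equivFin.symm (f.1 i)).1, ?_⟩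
      left_inv := fun f ↦ by simp
      right_inv := fun f ↦ by simp }
  · intro y
    have hy : (F.equivFin.symm y).1 ∈ univ.image f.1 := by
      rw [(mem_filter.mp f.2).2]
      exact (F.equivFin.symm y).2
    obtain ⟨i, -, hi⟩ := mem_image.mp hy
    exact ⟨i, by simp [hi]⟩
  · simp only [mem_filter, mem_univ, true_and]
    ext b
    simp only [mem_image, mem_univ, true_and]
    refine ⟨?_, fun hb ↦ ?_⟩
    · rintro ⟨i, rfl⟩
      exact (F.equivFin.symm (f.1 i)).2
    · obtain ⟨i, hi⟩ := f.2 (F.equivFin ⟨b, hb⟩)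
      exact ⟨i, by simp [hi]⟩

/-- Counting sequences by their set of values. -/
theorem card_filter_image_eq_sum {β : Type*} [Fintype β] [DecidableEq β]
    (p : Finset β → Prop) [DecidablePred p] (k : ℕ) :
    #{f : Fin k → β | p (univ.image f)} =
      ∑ j ∈ range (k + 1), surjCount k j * #{F : Finset β | p F ∧ #F = j} := by
  have hmaps : ∀ f ∈ ({f : Fin k → β | p (univ.image f)} : Finset _),
      univ.image f ∈ ({F : Finset β | p F ∧ #F ∈ range (k + 1)} : Finset _) := by
    intro f hf
    have := card_image_le (s := univ) (f := f)
    simp_all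
  rw [card_eq_sum_card_fiberwise hmaps]
  have hmaps' : ∀ F ∈ ({F : Finset β | p F ∧ #F ∈ range (k + 1)} : Finset _),
      #F ∈ range (k + 1) := fun F hF ↦ by simp_all
  rw [← sum_fiberwise_of_maps_to hmaps']
  refine sum_congr rfl fun j hj ↦ ?_
  rw [filter_filter, mul_comm, ← smul_eq_mul, ← sum_const]
  refine sum_congr ?_ fun F hF ↦ ?_
  · ext F
    simp only [mem_filter, mem_univ, true_and]
    constructor
    · rintro ⟨⟨h1, -⟩, h2⟩
      exact ⟨h1, h2⟩
    · rintro ⟨h1, rfl⟩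
      exact ⟨⟨h1, hj⟩, rfl⟩
  · simp only [mem_filter, mem_univ, true_and] at hF
    rw [← hF.2, ← card_filter_image_eq, filter_filter]
    congr 1
    ext f
    simp only [mem_filter, mem_univ, true_and]
    exact ⟨fun h ↦ h.2, fun h ↦ ⟨h ▸ hF.1, h⟩⟩

theorem pow_eq_sum_surjCount (N k : ℕ) :
    N ^ k = ∑ j ∈ range (k + 1), surjCount k j * N.choose j := by
  have h := card_filter_image_eq_sum (β := Fin N) (fun _ ↦ True) k
  simpa [Fintype.card_finset_len] using h

/-- The transform with matrix `surjCount` is injective. -/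
theorem eq_of_sum_surjCount_eq {a b : ℕ → ℤ}
    (h : ∀ k, ∑ j ∈ range (k + 1), (surjCount k j : ℤ) * a j =
      ∑ j ∈ range (k + 1), (surjCount k j : ℤ) * b j) (k : ℕ) : a k = b k := by
  induction k using Nat.strong_induction_on with
  | _ k ih =>
    have hk := h k
    rw [sum_range_succ, sum_range_succ,
      sum_congr rfl fun j hj ↦ by rw [ih j (mem_range.mp hj)]] at hk
    exact mul_left_cancel₀ (by exact_mod_cast (surjCount_self_pos k).ne') (add_left_cancel hk)

theorem stirling1_eq_zero_of_lt : ∀ {n k : ℕ}, n < k → stirling1 n k = 0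
  | 0, _ + 1, _ => rfl
  | n + 1, k + 1, h => by
    rw [stirling1, stirling1_eq_zero_of_lt (by omega), stirling1_eq_zero_of_lt (by omega)]
    simp

theorem sum_stirling1_mul_pow (m : ℕ) (x : ℤ) :
    ∑ i ∈ range (m + 1), (-1 : ℤ) ^ (m - i) * (stirling1 (m + 1) (i + 1) : ℤ) * x ^ i =
      (descPochhammer ℤ m).eval (x - 1) := by
  induction m with
  | zero => simp [stirling1]
  | succ m ih =>
    have hrec (i : ℕ) : (-1 : ℤ) ^ (m + 1 - i) * (stirling1 (m + 1 + 1) (i + 1) : ℤ) * x ^ i =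
        (-1) ^ (m + 1 - i) * ((m + 1) * stirling1 (m + 1) (i + 1)) * x ^ i +
          (-1) ^ (m + 1 - i) * stirling1 (m + 1) i * x ^ i := by
      rw [stirling1]
      push_cast
      ring
    rw [sum_congr rfl fun i _ ↦ hrec i, sum_add_distrib, descPochhammer_succ_eval, ← ih,
      sum_range_succ, stirling1_eq_zero_of_lt (by omega), sum_range_succ' _ (m + 1),
      show stirling1 (m + 1) 0 = 0 from rfl]
    simp only [Nat.cast_zero, mul_zero, zero_mul, add_zero]
    rw [← sum_add_distrib, sum_mul]
    refine sum_congr rfl fun i hi ↦ ?_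
    have hi' : i ≤ m := Nat.lt_succ_iff.mp (mem_range.mp hi)
    rw [Nat.succ_sub hi', Nat.add_sub_add_right, pow_succ]
    ring

/-- The partition into the fibres of a two-valued function. -/
def fibrePartition {n : ℕ} (g : Fin n → Bool) : Finset (Finset (Fin n)) :=
  univ.image fun x ↦ ({y | g y = g x} : Finset (Fin n))

theorem mem_fibrePartition {n : ℕ} {g : Fin n → Bool} {A : Finset (Fin n)} :
    A ∈ fibrePartition g ↔ ∃ x, ({y | g y = g x} : Finset (Fin n)) = A := by
  simp [fibrePartition]

theorem cuts_fibrePartition {n : ℕ} (g : Fin n → Bool) (x y : Fin n) :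
    Cuts (fibrePartition g) x y ↔ g x ≠ g y := by
  constructor
  · rintro ⟨A, hA, B, hB, hne, hx, hy⟩ hxy
    obtain ⟨a, rfl⟩ := mem_fibrePartition.mp hA
    obtain ⟨b, rfl⟩ := mem_fibrePartition.mp hB
    simp only [mem_filter, mem_univ, true_and] at hx hy
    exact hne (by rw [← hx, ← hy, hxy])
  · intro hxy
    refine ⟨_, mem_fibrePartition.mpr ⟨x, rfl⟩, _, mem_fibrePartition.mpr ⟨y, rfl⟩,
      fun h ↦ ?_, by simp, by simp⟩
    have hx : x ∈ ({z | g z = g y} : Finset (Fin n)) := h ▸ by simp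
    exact hxy (by simpa using hx)

theorem isBipartition_fibrePartition {n : ℕ} (g : Fin n → Bool) :
    IsBipartition univ (fibrePartition g) := by
  refine ⟨?_, ?_, ?_, ?_⟩
  · have hsub : fibrePartition g ⊆
        univ.image fun b : Bool ↦ ({y | g y = b} : Finset (Fin n)) := by
      intro A hA
      obtain ⟨x, rfl⟩ := mem_fibrePartition.mp hA
      exact mem_image_of_mem _ (mem_univ (g x))
    exact (card_le_card hsub).trans (card_image_le.trans (by simp))
  · intro A hA
    obtain ⟨x, rfl⟩ := mem_fibrePartition.mp hA
    exact ⟨x, by simp⟩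
  · intro A hA B hB hne
    obtain ⟨a, rfl⟩ := mem_fibrePartition.mp hA
    obtain ⟨b, rfl⟩ := mem_fibrePartition.mp hB
    refine disjoint_left.mpr fun z hz hz' ↦ hne ?_
    simp only [mem_filter, mem_univ, true_and] at hz hz'
    rw [← hz, ← hz']
  · refine eq_univ_of_forall fun x ↦ mem_sup.mpr ?_
    exact ⟨_, mem_fibrePartition.mpr ⟨x, rfl⟩, by simp⟩

/-- The bipartition of `Fin (m + 1)` whose block containing `0` is `{0} ∪ h⁻¹(false)`. -/
def rootedBipartition {m : ℕ} (h : Fin m → Bool) : Finset (Finset (Fin (m + 1))) :=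
  fibrePartition (Fin.cons false h : Fin (m + 1) → Bool)

theorem rootedBipartition_injective (m : ℕ) :
    Function.Injective (rootedBipartition : (Fin m → Bool) → _) := by
  intro h h' heq
  funext i
  have h1 := cuts_fibrePartition (Fin.cons false h : Fin (m + 1) → Bool) i.succ 0
  have h2 := cuts_fibrePartition (Fin.cons false h' : Fin (m + 1) → Bool) i.succ 0
  rw [rootedBipartition, rootedBipartition] at heq
  rw [heq, h2] at h1
  simpa using h1.symm

theorem exists_rootedBipartition_eq {m : ℕ} {P : Finset (Finset (Fin (m + 1)))}
    (hP : IsBipartition univ P) : ∃ h : Fin m → Bool, rootedBipartition h = P := by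
  obtain ⟨hcard, hne, hdisj, hsup⟩ := hP
  have hcover (x : Fin (m + 1)) : ∃ A ∈ P, x ∈ A := by
    have hx : x ∈ P.sup id := hsup ▸ mem_univ x
    simpa using mem_sup.mp hx
  obtain ⟨A, hA, h0⟩ := hcover 0
  have hcompl (C : Finset (Fin (m + 1))) (hC : C ∈ P) (hCA : C ≠ A) (y : Fin (m + 1)) :
      y ∈ C ↔ y ∉ A := by
    refine ⟨fun hy ↦ disjoint_left.mp (hdisj C hC A hA hCA) hy, fun hy ↦ ?_⟩
    obtain ⟨D, hD, hyD⟩ := hcover y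
    by_contra hyC
    have hDA : D ≠ A := fun h ↦ hy (h ▸ hyD)
    have hDC : D ≠ C := fun h ↦ hyC (h ▸ hyD)
    exact absurd (two_lt_card.mpr ⟨D, hD, C, hC, A, hA, hDC, hDA, hCA⟩) (by omega)
  have hg : (Fin.cons false fun i : Fin m ↦ decide (i.succ ∉ A) : Fin (m + 1) → Bool) =
      fun x ↦ decide (x ∉ A) := by
    funext x
    refine Fin.cases ?_ (fun i ↦ ?_) x
    · simp [h0]
    · simp
  have hclass (C : Finset (Fin (m + 1))) (hC : C ∈ P) (x : Fin (m + 1)) (hx : x ∈ C) :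
      ({y | decide (y ∉ A) = decide (x ∉ A)} : Finset (Fin (m + 1))) = C := by
    ext y
    by_cases hCA : C = A
    · subst hCA
      simp [hx]
    · have hxA := (hcompl C hC hCA x).mp hx
      simp [hxA, hcompl C hC hCA y]
  refine ⟨fun i ↦ decide (i.succ ∉ A), ?_⟩
  rw [rootedBipartition, hg]
  ext C
  rw [mem_fibrePartition]
  constructor
  · rintro ⟨x, rfl⟩
    obtain ⟨D, hD, hxD⟩ := hcover x
    rwa [hclass D hD x hxD]
  · intro hC
    obtain ⟨x, hx⟩ := hne C hC
    exact ⟨x, hclass C hC x hx⟩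

open Classical in
theorem tauSep_succ_eq_card (m k : ℕ) :
    tauSep (m + 1) k = #{F : Finset (Fin m → Bool) |
      IsSeparating univ (F.image rootedBipartition) ∧ #F = k} := by
  rw [tauSep, ← Set.ncard_coe_finset,
    ← Set.ncard_image_of_injective _ (image_injective (rootedBipartition_injective m))]
  congr 1
  ext F
  simp only [Set.mem_ofPred_eq, coe_filter, mem_univ, true_and, Set.mem_image]
  constructor
  · rintro ⟨hbip, hsep, hcard⟩
    have hF : ({h | rootedBipartition h ∈ F} : Finset (Fin m → Bool)).image rootedBipartition
        = F := by
      ext P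
      simp only [mem_image, mem_filter, mem_univ, true_and]
      constructor
      · rintro ⟨h, hh, rfl⟩
        exact hh
      · intro hP
        obtain ⟨h, rfl⟩ := exists_rootedBipartition_eq (hbip P hP)
        exact ⟨h, hP, rfl⟩
    refine ⟨_, ⟨hF.symm ▸ hsep, ?_⟩, hF⟩
    rw [← card_image_of_injective _ (rootedBipartition_injective m), hF, hcard]
  · rintro ⟨G, ⟨hsep, hcard⟩, rfl⟩
    refine ⟨fun P hP ↦ ?_, hsep, ?_⟩
    · obtain ⟨h, -, rfl⟩ := mem_image.mp hP
      exact isBipartition_fibrePartition _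
    · rw [card_image_of_injective _ (rootedBipartition_injective m), hcard]

theorem isSeparating_image_rootedBipartition {m k : ℕ} (f : Fin k → Fin m → Bool) :
    IsSeparating univ ((univ.image f).image rootedBipartition) ↔
      Function.Injective
        (Fin.cons (fun _ ↦ false) (fun j i ↦ f i j) : Fin (m + 1) → Fin k → Bool) := by
  have hcons (x : Fin (m + 1)) (i : Fin k) :
      (Fin.cons (fun _ ↦ false) (fun j i ↦ f i j) : Fin (m + 1) → Fin k → Bool) x i =
        (Fin.cons false (f i) : Fin (m + 1) → Bool) x := by
    refine Fin.cases ?_ (fun j ↦ ?_) x <;> simp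
  simp only [IsSeparating, mem_univ, true_implies, image_image, mem_image, true_and,
    exists_exists_eq_and, Function.comp_apply, rootedBipartition, cuts_fibrePartition]
  refine forall_congr' fun x ↦ forall_congr' fun y ↦ ?_
  rw [← not_imp_not, not_not, funext_iff]
  simp only [hcons]
  push Not
  tauto

theorem card_filter_cons_injective (m : ℕ) {β : Type*} [Fintype β] [DecidableEq β] (b : β) :
    #{c : Fin m → β | Function.Injective (Fin.cons b c : Fin (m + 1) → β)} =
      (Fintype.card β - 1).descFactorial m := by
  have hcard : Fintype.card {x : β // x ≠ b} = Fintype.card β - 1 := by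
    simp
  rw [← hcard, ← Fintype.card_fin m, ← Fintype.card_embedding_eq, ← Fintype.card_coe,
    Fintype.card_fin]
  refine Fintype.card_congr
    { toFun := fun c ↦ ⟨fun i ↦ ⟨c.1 i, ?_⟩, ?_⟩
      invFun := fun e ↦ ⟨fun i ↦ (e i).1, ?_⟩
      left_inv := fun c ↦ rfl
      right_inv := fun e ↦ rfl }
  · have hc := c.2
    simp only [mem_filter, mem_univ, true_and, Fin.cons_injective_iff] at hc
    exact fun h ↦ hc.1 ⟨i, h⟩
  · have hc := c.2
    simp only [mem_filter, mem_univ, true_and, Fin.cons_injective_iff] at hc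
    exact fun i j hij ↦ hc.2 (congrArg Subtype.val hij)
  · simp only [mem_filter, mem_univ, true_and, Fin.cons_injective_iff]
    refine ⟨?_, fun i j hij ↦ e.injective (Subtype.ext hij)⟩
    rintro ⟨i, hi⟩
    exact (e i).2 hi

theorem sum_surjCount_mul_tauSep (m k : ℕ) :
    ∑ j ∈ range (k + 1), surjCount k j * tauSep (m + 1) j = (2 ^ k - 1).descFactorial m := by
  classical
  simp only [tauSep_succ_eq_card]
  rw [← card_filter_image_eq_sum
    (fun F : Finset (Fin m → Bool) ↦ IsSeparating univ (F.image rootedBipartition))]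
  have h := card_filter_cons_injective m (fun _ : Fin k ↦ false)
  rw [Fintype.card_fun, Fintype.card_bool, Fintype.card_fin] at h
  rw [← h]
  refine card_equiv (Equiv.piComm fun _ _ ↦ Bool) fun f ↦ ?_
  simp only [mem_filter, mem_univ, true_and, isSeparating_image_rootedBipartition]
  rfl

theorem tauSep_succ_eq_sum (m k : ℕ) :
    (tauSep (m + 1) k : ℤ) = ∑ i ∈ range (m + 1),
      (-1 : ℤ) ^ (m - i) * (stirling1 (m + 1) (i + 1) : ℤ) * ((2 ^ i).choose k : ℕ) := by
  refine eq_of_sum_surjCount_eq (a := fun k ↦ (tauSep (m + 1) k : ℤ))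
    (b := fun k ↦ ∑ i ∈ range (m + 1),
      (-1 : ℤ) ^ (m - i) * (stirling1 (m + 1) (i + 1) : ℤ) * ((2 ^ i).choose k : ℕ))
    (fun k ↦ ?_) k
  have hleft := congrArg (Nat.cast : ℕ → ℤ) (sum_surjCount_mul_tauSep m k)
  rw [← descPochhammer_eval_eq_descFactorial, Nat.cast_sub Nat.one_le_two_pow] at hleft
  push_cast at hleft
  rw [← sum_stirling1_mul_pow] at hleft
  rw [hleft]
  simp only [mul_sum]
  rw [sum_comm]
  refine sum_congr rfl fun i _ ↦ ?_
  have hpow := congrArg (Nat.cast : ℕ → ℤ) (pow_eq_sum_surjCount (2 ^ i) k)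
  push_cast at hpow
  rw [pow_right_comm, hpow, mul_sum]
  exact sum_congr rfl fun j _ ↦ by ring

/-- For `2 ≤ n` and `2 ≤ k < 2 ^ (n - 1)`:
`τ_{n,k} = ∑_{i=1}^{n−1} (−1)^(n−1−i) · c(n, i+1) · C(2^i, k)`. -/
theorem tauSep_eq_sum_stirling1' (n k : ℕ) (hn : 2 ≤ n) (hk1 : 2 ≤ k)
    (hk2 : k < 2 ^ (n - 1)) :
    (tauSep n k : ℤ) =
      ∑ i ∈ Finset.Icc 1 (n - 1), (-1 : ℤ) ^ (n - 1 - i) * (stirling1 n (i + 1) : ℤ) *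
        (((2 ^ i).choose k : ℕ) : ℤ) := by
  obtain ⟨m, rfl⟩ := Nat.exists_eq_add_of_le' (show 1 ≤ n by omega)
  rw [tauSep_succ_eq_sum, Nat.add_sub_cancel]
  have hIcc : Icc 1 m = (range (m + 1)).erase 0 := by
    ext i
    simp only [mem_Icc, mem_erase, mem_range]
    omega
  rw [hIcc, sum_erase]
  simp [Nat.choose_eq_zero_of_lt hk1]
end

section
/- For every k ≥ 2, the number of separating families of k arbitrary bipartitions of a set of minimum admissible size n = ⌈log₂ k⌉ + 1 equals C(2^⌈log₂ k⌉, k), where C(·,·) is the binomial coefficient. -/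
open Finset

variable {α : Type*} [DecidableEq α]

/-- The bipartition of `univ` whose components are the nonempty sets among `A` and `Aᶜ`. -/
def bipartitionOf [Fintype α] (A : Finset α) : Finset (Finset α) :=
  ({A, Aᶜ} : Finset (Finset α)).erase ∅

lemma mem_bipartitionOf [Fintype α] {A B : Finset α} :
    B ∈ bipartitionOf A ↔ B.Nonempty ∧ (B = A ∨ B = Aᶜ) := by
  simp [bipartitionOf, nonempty_iff_ne_empty]

lemma isBipartition_bipartitionOf [Fintype α] (A : Finset α) :
    IsBipartition univ (bipartitionOf A) := by
  refine ⟨(card_le_card (erase_subset _ _)).trans card_le_two,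
    fun B hB => (mem_bipartitionOf.1 hB).1, fun B hB C hC hBC => ?_, ?_⟩
  · obtain ⟨-, rfl | rfl⟩ := mem_bipartitionOf.1 hB <;>
      obtain ⟨-, rfl | rfl⟩ := mem_bipartitionOf.1 hC
    · exact absurd rfl hBC
    · exact disjoint_compl_right
    · exact disjoint_compl_left
    · exact absurd rfl hBC
  · refine eq_univ_iff_forall.2 fun z => mem_sup.2 ?_
    by_cases hz : z ∈ A
    · exact ⟨A, mem_bipartitionOf.2 ⟨⟨z, hz⟩, Or.inl rfl⟩, hz⟩
    · have hz' : z ∈ Aᶜ := mem_compl.2 hz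
      exact ⟨Aᶜ, mem_bipartitionOf.2 ⟨⟨z, hz'⟩, Or.inr rfl⟩, hz'⟩

lemma bipartitionOf_injOn [Fintype α] (x : α) :
    Set.InjOn bipartitionOf {A : Finset α | x ∉ A} := by
  intro A hA B hB h
  have hxA : Aᶜ ∈ bipartitionOf A :=
    mem_bipartitionOf.2 ⟨⟨x, mem_compl.2 hA⟩, Or.inr rfl⟩
  rw [h, mem_bipartitionOf] at hxA
  obtain ⟨-, h' | h'⟩ := hxA
  · exact absurd (h' ▸ mem_compl.2 hA) hB
  · exact compl_injective h'

lemma IsBipartition.exists_eq_bipartitionOf [Fintype α] {P : Finset (Finset α)}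
    (hP : IsBipartition univ P) (x : α) :
    ∃ A, x ∉ A ∧ (∀ y ∈ A, Cuts P x y) ∧ P = bipartitionOf A := by
  obtain ⟨hcard, hne, hdisj, hsup⟩ := hP
  have hcover : ∀ z, ∃ E ∈ P, z ∈ E := fun z => mem_sup.1 (hsup ▸ mem_univ z)
  obtain ⟨C, hC, hxC⟩ := hcover x
  have heq : ∀ E ∈ P, E ≠ C → E = Cᶜ := by
    intro E hE hEC
    ext z
    rw [mem_compl]
    refine ⟨fun hz hzC => disjoint_left.1 (hdisj E hE C hC hEC) hz hzC, fun hz => ?_⟩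
    obtain ⟨G, hG, hzG⟩ := hcover z
    by_cases hGE : G = E
    · exact hGE ▸ hzG
    · have hGC : G ≠ C := fun h => hz (h ▸ hzG)
      exact absurd hcard (not_le.2 (two_lt_card.2 ⟨G, hG, E, hE, C, hC, hGE, hGC, hEC⟩))
  have hmem : ∀ z ∈ Cᶜ, Cᶜ ∈ P := by
    intro z hz
    obtain ⟨E, hE, hzE⟩ := hcover z
    have hEC : E ≠ C := fun h => mem_compl.1 hz (h ▸ hzE)
    exact heq E hE hEC ▸ hE
  refine ⟨Cᶜ, fun h => mem_compl.1 h hxC, fun y hy => ?_, ?_⟩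
  · exact ⟨C, hC, Cᶜ, hmem y hy, fun h => mem_compl.1 hy (h ▸ hy), hxC, hy⟩
  · ext B
    rw [mem_bipartitionOf, compl_compl]
    constructor
    · intro hB
      refine ⟨hne B hB, ?_⟩
      by_cases h : B = C
      · exact Or.inr h
      · exact Or.inl (heq B hB h)
    · rintro ⟨⟨z, hz⟩, rfl | rfl⟩
      · exact hmem z hz
      · exact hC

/-- The finset of all bipartitions of `univ`. -/
def bipartitions (α : Type*) [DecidableEq α] [Fintype α] : Finset (Finset (Finset α)) :=
  univ.image bipartitionOf

lemma mem_bipartitions [Fintype α] [Nonempty α] {P : Finset (Finset α)} :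
    P ∈ bipartitions α ↔ IsBipartition univ P := by
  simp only [bipartitions, mem_image, mem_univ, true_and]
  constructor
  · rintro ⟨A, rfl⟩
    exact isBipartition_bipartitionOf A
  · intro hP
    obtain ⟨A, -, -, h⟩ := hP.exists_eq_bipartitionOf (Classical.arbitrary α)
    exact ⟨A, h.symm⟩

lemma card_bipartitions [Fintype α] [Nonempty α] :
    (bipartitions α).card = 2 ^ (Fintype.card α - 1) := by
  let x : α := Classical.arbitrary α
  have h : bipartitions α = (univ.erase x).powerset.image bipartitionOf := by
    ext P
    constructor
    · intro hP
      obtain ⟨A, hxA, -, h⟩ := (mem_bipartitions.1 hP).exists_eq_bipartitionOf x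
      exact mem_image.2
        ⟨A, mem_powerset.2 (subset_erase.2 ⟨subset_univ A, hxA⟩), h.symm⟩
    · exact fun hP => image_subset_image (subset_univ _) hP
  rw [h, card_image_of_injOn, card_powerset, card_erase_of_mem (mem_univ x), card_univ]
  refine (bipartitionOf_injOn x).mono fun A hA => ?_
  exact (subset_erase.1 (mem_powerset.1 hA)).2

/-- A family of bipartitions having more members than there are bipartitions
with two given elements in the same component is separating. -/
lemma isSeparating_of_two_pow_lt_card [Fintype α] {F : Finset (Finset (Finset α))}
    (hF : ∀ P ∈ F, IsBipartition univ P) (hcard : 2 ^ (Fintype.card α - 2) < F.card) :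
    IsSeparating univ F := by
  intro x _ y _ hxy
  by_contra! hcut
  have hsub : F ⊆ ((univ.erase x).erase y).powerset.image bipartitionOf := by
    intro P hP
    obtain ⟨A, hxA, hA, h⟩ := (hF P hP).exists_eq_bipartitionOf x
    refine mem_image.2 ⟨A, mem_powerset.2 ?_, h.symm⟩
    exact subset_erase.2
      ⟨subset_erase.2 ⟨subset_univ A, hxA⟩, fun hy => hcut P hP (hA y hy)⟩
  have hle := (card_le_card hsub).trans card_image_le
  rw [card_powerset, card_erase_of_mem (mem_erase.2 ⟨hxy.symm, mem_univ y⟩),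
    card_erase_of_mem (mem_univ x), card_univ, Nat.sub_sub] at hle
  exact absurd hle (not_le.2 hcard)

/-- For every `k ≥ 2`, the number of separating families of `k` arbitrary bipartitions
of a set of minimum admissible size `⌈log₂ k⌉ + 1` equals `C(2^⌈log₂ k⌉, k)`. -/
theorem card_separating_minSet (k : ℕ) (hk : 2 ≤ k) :
    tauSep (Nat.clog 2 k + 1) k = (2 ^ Nat.clog 2 k).choose k := by
  have hlt : 2 ^ (Nat.clog 2 k - 1) < k := Nat.pow_pred_clog_lt_self one_lt_two hk
  have hset : {F : Finset (Finset (Finset (Fin (Nat.clog 2 k + 1)))) |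
      (∀ P ∈ F, IsBipartition Finset.univ P) ∧
        IsSeparating Finset.univ F ∧ F.card = k} =
      ((bipartitions (Fin (Nat.clog 2 k + 1))).powersetCard k : Set _) := by
    ext F
    simp only [Set.mem_ofPred_eq, mem_coe, mem_powersetCard, subset_iff, mem_bipartitions]
    refine ⟨fun ⟨hF, _, hc⟩ => ⟨hF, hc⟩, fun ⟨hF, hc⟩ => ⟨hF, ?_, hc⟩⟩
    refine isSeparating_of_two_pow_lt_card hF ?_
    rw [Fintype.card_fin, hc]
    exact hlt
  rw [tauSep, hset, Set.ncard_coe_finset, card_powersetCard, card_bipartitions,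
    Fintype.card_fin, Nat.add_sub_cancel]
end

section
/- For every k ≥ 1, the number of separating families of k proper bipartitions of a set of minimum admissible size n = ⌈log₂(k+1)⌉ + 1 equals C(2^⌈log₂(k+1)⌉ − 1, k), where C(·,·) is the binomial coefficient. -/
open Finset

variable {α : Type*} [DecidableEq α]

/-- `sigmaSep n k` is the number of separating families consisting of `k` proper
bipartitions (bipartitions with exactly two components) of an `n`-element set. -/
noncomputable def sigmaSep (n k : ℕ) : ℕ :=
  Set.ncard {F : Finset (Finset (Finset (Fin n))) |
    (∀ P ∈ F, IsBipartition Finset.univ P ∧ P.card = 2) ∧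
      IsSeparating Finset.univ F ∧ F.card = k}

/-- The collection consisting of a set and its complement. -/
def complPair [Fintype α] (A : Finset α) : Finset (Finset α) := {A, Aᶜ}

/-- The nonempty sets avoiding `a`. -/
def nonemptyAvoiding [Fintype α] (a : α) : Finset (Finset α) :=
  (univ.erase a).powerset.erase ∅

lemma mem_nonemptyAvoiding [Fintype α] {a : α} {A : Finset α} :
    A ∈ nonemptyAvoiding a ↔ A ≠ ∅ ∧ a ∉ A := by
  simp [nonemptyAvoiding, Finset.subset_erase]

lemma card_nonemptyAvoiding [Fintype α] (a : α) :
    (nonemptyAvoiding a).card = 2 ^ (Fintype.card α - 1) - 1 := by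
  rw [nonemptyAvoiding, card_erase_of_mem (by simp), card_powerset,
    card_erase_of_mem (mem_univ a), card_univ]

lemma complPair_injOn [Fintype α] (a : α) :
    Set.InjOn complPair (nonemptyAvoiding a : Set (Finset α)) := by
  intro A hA B hB h
  rw [mem_coe, mem_nonemptyAvoiding] at hA hB
  have hmem : A ∈ complPair B := h ▸ mem_insert_self A {Aᶜ}
  rw [complPair, mem_insert, mem_singleton] at hmem
  rcases hmem with h1 | h1
  · exact h1
  · exact absurd (h1 ▸ mem_compl.2 hB.2) hA.2

lemma isBipartition_univ_and_card_eq_two_iff [Fintype α] (a : α) (P : Finset (Finset α)) :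
    IsBipartition univ P ∧ P.card = 2 ↔ P ∈ (nonemptyAvoiding a).image complPair := by
  rw [mem_image]
  constructor
  · rintro ⟨⟨-, hne, hdisj, hsup⟩, hcard⟩
    obtain ⟨A, B, hAB, rfl⟩ := card_eq_two.1 hcard
    have hd : Disjoint A B := hdisj A (by simp) B (by simp) hAB
    have hu : A ∪ B = univ := by simpa using hsup
    have hB : Aᶜ = B := (IsCompl.of_eq hd.eq_bot hu).compl_eq
    have hA : Bᶜ = A := by rw [← hB, compl_compl]
    by_cases haA : a ∈ A
    · refine ⟨B, mem_nonemptyAvoiding.2 ⟨(hne B (by simp)).ne_empty, ?_⟩, ?_⟩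
      · exact Finset.disjoint_left.1 hd haA
      · rw [complPair, hA, pair_comm]
    · refine ⟨A, mem_nonemptyAvoiding.2 ⟨(hne A (by simp)).ne_empty, haA⟩, ?_⟩
      rw [complPair, hB]
  · rintro ⟨A, hA, rfl⟩
    rw [mem_nonemptyAvoiding] at hA
    have hAc : Aᶜ.Nonempty := ⟨a, mem_compl.2 hA.2⟩
    have hne : A ≠ Aᶜ := fun h => hA.2 (h ▸ mem_compl.2 hA.2)
    have hcard : (complPair A).card = 2 := card_pair hne
    refine ⟨⟨hcard.le, ?_, ?_, ?_⟩, hcard⟩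
    · simp [complPair, nonempty_iff_ne_empty.2 hA.1, hAc]
    · intro B hB C hC hBC
      simp only [complPair, mem_insert, mem_singleton] at hB hC
      rcases hB with rfl | rfl <;> rcases hC with rfl | rfl
      · exact absurd rfl hBC
      · exact disjoint_compl_right
      · exact disjoint_compl_left
      · exact absurd rfl hBC
    · simp [complPair]

lemma cuts_complPair [Fintype α] {A : Finset α} {x y : α} (h : ¬ (x ∈ A ↔ y ∈ A)) :
    Cuts (complPair A) x y := by
  have hx : ∀ z, z ∈ A → z ∉ Aᶜ := fun z hz hz' => mem_compl.1 hz' hz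
  have hne : A ≠ Aᶜ := by
    intro h2
    by_cases hz : x ∈ A
    · exact hx x hz (h2 ▸ hz)
    · exact hz (h2 ▸ mem_compl.2 hz)
  by_cases hxA : x ∈ A
  · refine ⟨A, by simp [complPair], Aᶜ, by simp [complPair], hne, hxA, mem_compl.2 ?_⟩
    tauto
  · refine ⟨Aᶜ, by simp [complPair], A, by simp [complPair], hne.symm, mem_compl.2 hxA, ?_⟩
    tauto

lemma Cuts.symm {β : Type*} {P : Finset (Finset β)} {x y : β} (h : Cuts P x y) : Cuts P y x := by
  obtain ⟨A, hA, B, hB, hAB, hx, hy⟩ := h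
  exact ⟨B, hB, A, hA, hAB.symm, hy, hx⟩

/-- At most `2 ^ (n - 2) - 1` nonempty sets avoiding `a` do not tell `x` and `y` apart. -/
lemma card_filter_mem_iff_mem_le [Fintype α] {a x y : α} (hxy : x ≠ y) (hy : y ≠ a) :
    ((nonemptyAvoiding a).filter fun A => x ∈ A ↔ y ∈ A).card
      ≤ 2 ^ (Fintype.card α - 2) - 1 := by
  have hcard : (((univ.erase a).erase y).powerset.erase ∅).card
      = 2 ^ (Fintype.card α - 2) - 1 := by
    rw [card_erase_of_mem (by simp), card_powerset, card_erase_of_mem (by simp [hy]),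
      card_erase_of_mem (mem_univ a), card_univ, Nat.sub_sub]
  rw [← hcard]
  refine card_le_card_of_injOn (fun A => A.erase y) ?_ ?_
  · intro A hA
    simp only [mem_coe, mem_filter, mem_nonemptyAvoiding] at hA
    obtain ⟨⟨hne, ha⟩, hiff⟩ := hA
    simp only [mem_coe, mem_erase, mem_powerset]
    refine ⟨?_, erase_subset_erase y fun z hz => ?_⟩
    · obtain ⟨z, hz⟩ := nonempty_iff_ne_empty.2 hne
      rw [← nonempty_iff_ne_empty]
      by_cases hzy : z = y
      · exact ⟨x, mem_erase.2 ⟨hxy, hiff.2 (hzy ▸ hz)⟩⟩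
      · exact ⟨z, mem_erase.2 ⟨hzy, hz⟩⟩
    · exact mem_erase.2 ⟨fun h => ha (h ▸ hz), mem_univ z⟩
  · intro A hA B hB h
    simp only [mem_coe, mem_filter] at hA hB
    have key : ∀ z, z ≠ y → (z ∈ A ↔ z ∈ B) := by
      intro z hz
      have := Finset.ext_iff.1 h z
      simpa [hz] using this
    ext z
    by_cases hz : z = y
    · rw [hz, ← hA.2, ← hB.2]
      exact key x hxy
    · exact key z hz

/-- A family of at least `2 ^ (n - 2)` proper bipartitions of an `n`-element set is separating. -/
lemma isSeparating_of_pow_le_card [Fintype α] (a : α) {F : Finset (Finset (Finset α))}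
    (hF : F ⊆ (nonemptyAvoiding a).image complPair)
    (hcard : 2 ^ (Fintype.card α - 2) ≤ F.card) : IsSeparating univ F := by
  have main : ∀ x y : α, x ≠ y → y ≠ a → ∃ P ∈ F, Cuts P x y := by
    intro x y hxy hy
    by_contra! hcut
    have hsub : F ⊆ ((nonemptyAvoiding a).filter fun A => x ∈ A ↔ y ∈ A).image complPair := by
      intro P hP
      obtain ⟨A, hA, rfl⟩ := mem_image.1 (hF hP)
      refine mem_image_of_mem _ (mem_filter.2 ⟨hA, ?_⟩)
      by_contra h
      exact hcut _ hP (cuts_complPair h)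
    have h1 := (card_le_card hsub).trans (card_image_le.trans (card_filter_mem_iff_mem_le hxy hy))
    have h2 : 0 < 2 ^ (Fintype.card α - 2) := by positivity
    omega
  intro x _ y _ hxy
  by_cases hy : y = a
  · obtain ⟨P, hP, h⟩ := main y x hxy.symm (hy ▸ hxy)
    exact ⟨P, hP, h.symm⟩
  · exact main x y hxy hy

/-- For every `k ≥ 1`, the number of separating families of `k` proper bipartitions of a
set of minimum admissible size `⌈log₂ (k+1)⌉ + 1` equals `C(2^⌈log₂ (k+1)⌉ − 1, k)`. -/
theorem card_separating_proper_minSet (k : ℕ) (hk : 1 ≤ k) :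
    sigmaSep (Nat.clog 2 (k + 1) + 1) k = (2 ^ Nat.clog 2 (k + 1) - 1).choose k := by
  have hlt : 2 ^ (Nat.clog 2 (k + 1) - 1) < k + 1 :=
    Nat.pow_pred_clog_lt_self (by norm_num) (by omega)
  generalize Nat.clog 2 (k + 1) = m at hlt ⊢
  have hset : {F : Finset (Finset (Finset (Fin (m + 1)))) |
      (∀ P ∈ F, IsBipartition Finset.univ P ∧ P.card = 2) ∧
        IsSeparating Finset.univ F ∧ F.card = k} =
      (powersetCard k ((nonemptyAvoiding (0 : Fin (m + 1))).image complPair) :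
        Finset (Finset (Finset (Finset (Fin (m + 1)))))) := by
    ext F
    simp only [Set.mem_ofPred_eq, mem_coe, mem_powersetCard,
      isBipartition_univ_and_card_eq_two_iff (0 : Fin (m + 1))]
    constructor
    · rintro ⟨h1, -, h3⟩
      exact ⟨h1, h3⟩
    · rintro ⟨h1, h3⟩
      refine ⟨h1, isSeparating_of_pow_le_card 0 h1 ?_, h3⟩
      rw [Fintype.card_fin, h3, show m + 1 - 2 = m - 1 by omega]
      omega
  rw [sigmaSep, hset, Set.ncard_coe_finset, card_powersetCard,
    card_image_of_injOn (complPair_injOn 0), card_nonemptyAvoiding, Fintype.card_fin,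
    Nat.add_sub_cancel]
end
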